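/- arXiv:1909.03426 — 3 statements merged into one kernel-verified Lean document; each statement's English description precedes it below -/
import Mathlib

section
/- Let p be a prime and q = p^s with q − 1 = ef for integers e, f > 1, and suppose f < log_{√14}( p^{ord_f(p)} ). Suppose there exists a subset T of ℤ_f of size n such that every nonzero element of ℤ_f appears at most twice in the multiset T − T = {x − y : x, y ∈ T}. Then there exists a 2-dimensional Reed–Solomon code over F_q of length n with minimum insdel distance at least 2n − 4. -/
/-- `b` is obtained from `a` by a single symbol insertion or deletion. -/
def InsDelStep {α : Type*} (a b : List α) : Prop :=
  (∃ (l r : List α) (x : α), a = l ++ x :: r ∧ b = l ++ r) ∨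
  (∃ (l r : List α) (x : α), b = l ++ x :: r ∧ a = l ++ r)

/-- The insdel distance: the minimum number of single-symbol insertions and
deletions needed to transform `a` into `b`. -/
noncomputable def insdelDist {α : Type*} (a b : List α) : ℕ :=
  sInf {m : ℕ | ∃ c : ℕ → List α, c 0 = a ∧ c m = b ∧ ∀ i < m, InsDelStep (c i) (c (i + 1))}

/-- The minimum insdel distance of a code `C ⊆ F^n`. -/
noncomputable def codeInsdelDist {F : Type*} {n : ℕ} (C : Set (Fin n → F)) : ℕ :=
  sInf {m : ℕ | ∃ c1 ∈ C, ∃ c2 ∈ C, c1 ≠ c2 ∧ m = insdelDist (List.ofFn c1) (List.ofFn c2)}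

section InsDel

variable {α : Type*}

lemma InsDelStep.symm {a b : List α} (h : InsDelStep a b) : InsDelStep b a :=
  Or.symm h

lemma insDelStep_cons (x : α) (a : List α) : InsDelStep (x :: a) a :=
  Or.inl ⟨[], a, x, rfl, rfl⟩

lemma InsDelStep.exists_path_of_reflTransGen {a b : List α}
    (h : Relation.ReflTransGen InsDelStep a b) :
    ∃ (m : ℕ) (c : ℕ → List α), c 0 = a ∧ c m = b ∧ ∀ i < m, InsDelStep (c i) (c (i + 1)) := by
  induction h with
  | refl => exact ⟨0, fun _ => a, rfl, rfl, by simp⟩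
  | @tail b d _ hbd ih =>
    obtain ⟨m, c, h0, hm, hc⟩ := ih
    refine ⟨m + 1, fun i => if i ≤ m then c i else d, by simpa using h0, by simp, fun i hi => ?_⟩
    rcases (Nat.lt_succ_iff.mp hi).lt_or_eq with hlt | rfl
    · simpa [hlt.le, Nat.succ_le_iff.mpr hlt] using hc i hlt
    · simpa [hm] using hbd

lemma InsDelStep.reflTransGen_nil (a : List α) : Relation.ReflTransGen InsDelStep a [] := by
  induction a with
  | nil => exact .refl
  | cons x a ih => exact .head (insDelStep_cons x a) ih

lemma InsDelStep.reflTransGen (a b : List α) : Relation.ReflTransGen InsDelStep a b :=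
  have : Std.Symm (InsDelStep (α := α)) := ⟨fun _ _ => InsDelStep.symm⟩
  (reflTransGen_nil a).trans (Relation.ReflTransGen.stdSymm.symm _ _ (reflTransGen_nil b))

lemma insdelDist_spec (a b : List α) :
    ∃ c : ℕ → List α, c 0 = a ∧ c (insdelDist a b) = b ∧
      ∀ i < insdelDist a b, InsDelStep (c i) (c (i + 1)) :=
  Nat.sInf_mem (s := {m : ℕ | ∃ c : ℕ → List α, c 0 = a ∧ c m = b ∧
    ∀ i < m, InsDelStep (c i) (c (i + 1))})
    (InsDelStep.exists_path_of_reflTransGen (InsDelStep.reflTransGen a b))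

lemma List.Sublist.exists_sublist_of_delete {l r w : List α} {x : α}
    (h : w.Sublist (l ++ x :: r)) :
    ∃ w' : List α, w'.Sublist w ∧ w'.Sublist (l ++ r) ∧ w.length ≤ w'.length + 1 := by
  obtain ⟨w₁, w₂, rfl, h₁, h₂⟩ := List.sublist_append_iff.mp h
  rcases List.sublist_cons_iff.mp h₂ with h₂ | ⟨w₃, rfl, h₃⟩
  · exact ⟨w₁ ++ w₂, .refl _, h₁.append h₂, by simp⟩
  · exact ⟨w₁ ++ w₃, (List.Sublist.refl _).append (List.sublist_cons_self _ _), h₁.append h₃,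
      by simp; omega⟩

lemma exists_common_sublist_of_path (m : ℕ) (c : ℕ → List α)
    (hc : ∀ i < m, InsDelStep (c i) (c (i + 1))) :
    ∃ w : List α, w.Sublist (c 0) ∧ w.Sublist (c m) ∧
      (c 0).length + (c m).length ≤ 2 * w.length + m := by
  induction m with
  | zero => exact ⟨c 0, .refl _, .refl _, by omega⟩
  | succ m ih =>
    obtain ⟨w, hw0, hwm, hlen⟩ := ih fun i hi => hc i (by omega)
    rcases hc m (by omega) with ⟨l, r, x, h1, h2⟩ | ⟨l, r, x, h1, h2⟩
    · rw [h1] at hwm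
      obtain ⟨w', hw', hw'', hl⟩ := hwm.exists_sublist_of_delete
      refine ⟨w', hw'.trans hw0, h2 ▸ hw'', ?_⟩
      simp only [h1, h2, List.length_append, List.length_cons] at hlen ⊢
      omega
    · refine ⟨w, hw0, ?_, ?_⟩
      · rw [h1]
        rw [h2] at hwm
        exact hwm.trans ((List.Sublist.refl _).append (List.sublist_cons_self _ _))
      · simp only [h1, h2, List.length_append, List.length_cons] at hlen ⊢
        omega

/-- Every pair of lists has a common subsequence accounting for their insdel distance. -/
lemma exists_common_sublist (a b : List α) :
    ∃ w : List α, w.Sublist a ∧ w.Sublist b ∧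
      a.length + b.length ≤ 2 * w.length + insdelDist a b := by
  obtain ⟨c, h0, hm, hc⟩ := insdelDist_spec a b
  simpa [h0, hm] using exists_common_sublist_of_path _ c hc

lemma exists_injective_matching_of_sublist_ofFn {n k : ℕ} {c d : Fin n → α} {w : List α}
    (hc : w.Sublist (List.ofFn c)) (hd : w.Sublist (List.ofFn d)) (hk : k ≤ w.length) :
    ∃ i j : Fin k → Fin n, Function.Injective i ∧ Function.Injective j ∧
      ∀ t, c (i t) = d (j t) := by
  obtain ⟨u, hu⟩ := List.sublist_iff_exists_fin_orderEmbedding_get_eq.mp hc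
  obtain ⟨v, hv⟩ := List.sublist_iff_exists_fin_orderEmbedding_get_eq.mp hd
  refine ⟨fun t => Fin.cast (by simp) (u (Fin.castLE hk t)),
    fun t => Fin.cast (by simp) (v (Fin.castLE hk t)), ?_, ?_, fun t => ?_⟩
  · exact (Fin.cast_injective _).comp (u.injective.comp (Fin.castLE_injective hk))
  · exact (Fin.cast_injective _).comp (v.injective.comp (Fin.castLE_injective hk))
  · have := (hu (Fin.castLE hk t)).symm.trans (hv (Fin.castLE hk t))
    simpa only [List.get_ofFn] using this

end InsDel

section CharacterSums

open Finset ComplexConjugate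

/-- Parseval's identity for an integer combination of group elements. -/
lemma sum_addChar_norm_sq {G ι : Type*} [AddCommGroup G] [Fintype G] [DecidableEq G] [Fintype ι]
    (c : ι → ℤ) (k : ι → G) :
    ∑ χ : AddChar G ℂ, ‖∑ i, (c i : ℂ) * χ (k i)‖ ^ 2 =
      Fintype.card G * ((∑ i, ∑ j, if k i = k j then c i * c j else 0 : ℤ) : ℝ) := by
  have key (χ : AddChar G ℂ) : ((‖∑ i, (c i : ℂ) * χ (k i)‖ ^ 2 : ℝ) : ℂ) =
      ∑ i, ∑ j, ((c i * c j : ℤ) : ℂ) * χ (k i - k j) := by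
    push_cast
    rw [← Complex.mul_conj', map_sum, sum_mul_sum]
    refine sum_congr rfl fun i _ => sum_congr rfl fun j _ => ?_
    rw [map_mul, ← AddChar.map_neg_eq_conj, sub_eq_add_neg, AddChar.map_add_eq_mul]
    simp only [map_intCast]
    ring
  apply Complex.ofReal_injective
  rw [Complex.ofReal_sum, Fintype.sum_congr _ _ key]
  push_cast
  rw [sum_comm, mul_sum]
  refine sum_congr rfl fun i _ => ?_
  rw [sum_comm, mul_sum]
  refine sum_congr rfl fun j _ => ?_
  rw [← mul_sum, AddChar.sum_apply_eq_ite]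
  simp only [sub_eq_zero]
  split_ifs <;> simp [mul_comm]

lemma sum_norm_sq_le_of_injective {G ι J : Type*} [AddCommGroup G] [Fintype G] [DecidableEq G]
    [Fintype ι] [Fintype J] {Φ : J → AddChar G ℂ} (hΦ : Function.Injective Φ) (c : ι → ℤ)
    (k : ι → G) {M : ℕ} (hE : (∑ i, ∑ j, if k i = k j then c i * c j else 0) ≤ (M : ℤ)) :
    ∑ t, ‖∑ i, (c i : ℂ) * Φ t (k i)‖ ^ 2 ≤ M * Fintype.card G := by
  calc ∑ t, ‖∑ i, (c i : ℂ) * Φ t (k i)‖ ^ 2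
      = ∑ χ ∈ univ.map ⟨Φ, hΦ⟩, ‖∑ i, (c i : ℂ) * χ (k i)‖ ^ 2 := by
        rw [sum_map, Function.Embedding.coeFn_mk]
    _ ≤ ∑ χ : AddChar G ℂ, ‖∑ i, (c i : ℂ) * χ (k i)‖ ^ 2 :=
        sum_le_sum_of_subset_of_nonneg (subset_univ _) fun _ _ _ => by positivity
    _ = Fintype.card G * ((∑ i, ∑ j, if k i = k j then c i * c j else 0 : ℤ) : ℝ) :=
        sum_addChar_norm_sq c k
    _ ≤ Fintype.card G * M := by gcongr; exact_mod_cast hE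
    _ = M * Fintype.card G := mul_comm _ _

lemma prod_le_pow_of_sum_le {ι : Type*} (s : Finset ι) (x : ι → ℝ) (hx : ∀ i ∈ s, 0 ≤ x i)
    {M : ℝ} (hM : Real.exp 1 ≤ M) {N : ℕ} (hN : s.card ≤ N) (hsum : ∑ i ∈ s, x i ≤ M * N) :
    ∏ i ∈ s, x i ≤ M ^ N := by
  have hM0 : 0 < M := (Real.exp_pos 1).trans_le hM
  calc ∏ i ∈ s, x i ≤ ∏ i ∈ s, M * Real.exp (x i / M - 1) := by
        refine prod_le_prod hx fun i _ => ?_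
        have := Real.add_one_le_exp (x i / M - 1)
        rw [sub_add_cancel, div_le_iff₀' hM0] at this
        exact this
    _ = M ^ s.card * Real.exp (∑ i ∈ s, x i / M - s.card) := by
        rw [prod_mul_distrib, prod_const, ← Real.exp_sum]
        simp
    _ ≤ M ^ s.card * Real.exp ((N - s.card : ℕ) * 1) := by
        gcongr
        rw [← sum_div, Nat.cast_sub hN, mul_one]
        gcongr
        rwa [div_le_iff₀' hM0]
    _ ≤ M ^ s.card * M ^ (N - s.card) := by
        rw [Real.exp_nat_mul]
        gcongr
    _ = M ^ N := by rw [← pow_add, Nat.add_sub_cancel' hN]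

end CharacterSums

section Cyclotomic

open Finset NumberField

variable {f : ℕ} [NeZero f] {K : Type*} [Field K] [NumberField K] [IsCyclotomicExtension {f} ℚ K]
  {ζ : K} {ι : Type*} [Fintype ι]

lemma ringHom_compAddChar_injective (hζ : IsPrimitiveRoot ζ f) :
    Function.Injective fun σ : K →ₐ[ℚ] ℂ =>
      (σ : K →* ℂ).compAddChar (AddChar.zmodChar f hζ.pow_eq_one) := by
  intro σ τ h
  refine (hζ.powerBasis ℚ).algHom_ext ?_
  have h1 := DFunLike.congr_fun h ((1 : ℕ) : ZMod f)
  simp only [MonoidHom.coe_compAddChar, Function.comp_apply, AddChar.zmodChar_apply',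
    pow_one] at h1
  simpa using h1

/-- The norm of an integer combination of `f`-th roots of unity is bounded in terms of
its coefficients. -/
lemma norm_sq_le_of_energy_le (hζ : IsPrimitiveRoot ζ f) (c : ι → ℤ) (k : ι → ZMod f) {M : ℕ}
    (hM : 3 ≤ M) (hE : (∑ i, ∑ j, if k i = k j then c i * c j else 0) ≤ (M : ℤ)) :
    ‖(algebraMap ℚ ℂ (Algebra.norm ℚ
      (∑ i, (c i : K) * AddChar.zmodChar f hζ.pow_eq_one (k i))))‖ ^ 2 ≤ (M : ℝ) ^ f := by
  classical
  rw [Algebra.norm_eq_prod_embeddings, norm_prod, ← prod_pow]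
  set Φ : (K →ₐ[ℚ] ℂ) → AddChar (ZMod f) ℂ := fun σ =>
    (σ : K →* ℂ).compAddChar (AddChar.zmodChar f hζ.pow_eq_one) with hΦ
  have hinj : Function.Injective Φ := ringHom_compAddChar_injective hζ
  have hterm (σ : K →ₐ[ℚ] ℂ) :
      σ (∑ i, (c i : K) * AddChar.zmodChar f hζ.pow_eq_one (k i)) =
        ∑ i, (c i : ℂ) * Φ σ (k i) := by
    simp [hΦ, map_sum]
  simp only [hterm]
  refine prod_le_pow_of_sum_le _ _ (fun _ _ => by positivity) ?_ ?_ ?_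
  · have : (3 : ℝ) ≤ M := by exact_mod_cast hM
    linarith [Real.exp_one_lt_d9]
  · rw [card_univ]
    refine (Fintype.card_le_of_injective Φ hinj).trans_eq ?_
    rw [AddChar.card_eq, ZMod.card]
  · exact (sum_norm_sq_le_of_injective hinj c k hE).trans_eq (by rw [ZMod.card])

end Cyclotomic

section Reduction

open Finset NumberField

variable {f : ℕ} [NeZero f]

lemma zmodChar_injective {R : Type*} [Field R] {z : R} (hz : IsPrimitiveRoot z f) :
    Function.Injective (AddChar.zmodChar f hz.pow_eq_one) := by
  refine AddChar.injective_iff.mpr fun x hx => ?_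
  rw [AddChar.zmodChar_apply, hz.pow_eq_one_iff_dvd] at hx
  exact (ZMod.val_eq_zero x).mp (Nat.eq_zero_of_dvd_of_lt hx (ZMod.val_lt x))

lemma orderOf_le_of_primitiveRoot_mem_subring {p : ℕ} {F : Type*} [Field F] [Finite F] [CharP F p]
    {z : F} (hz : IsPrimitiveRoot z f) (R : Subring F) (hzR : z ∈ R) :
    ∃ m, Nat.card R = p ^ m ∧ orderOf (p : ZMod f) ≤ m := by
  classical
  have := Fintype.ofFinite R
  let _ : Field R := Fintype.fieldOfDomain R
  obtain ⟨m, hp, hm⟩ := FiniteField.card R p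
  refine ⟨m, by rw [Nat.card_eq_fintype_card, hm], ?_⟩
  have hz0 : (⟨z, hzR⟩ : R) ≠ 0 := fun h => hz.ne_zero (NeZero.ne f) (congrArg Subtype.val h)
  have h1 : z ^ (p ^ (m : ℕ) - 1) = 1 := by
    have := FiniteField.pow_card_sub_one_eq_one _ hz0
    rw [hm] at this
    exact congrArg Subtype.val this
  refine Nat.le_of_dvd m.pos (orderOf_dvd_of_pow_eq_one ?_)
  have h2 := (ZMod.natCast_eq_zero_iff _ f).mpr (hz.dvd_of_pow_eq_one _ h1)
  rw [Nat.cast_sub (Nat.one_le_pow _ _ hp.pos)] at h2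
  simpa [sub_eq_zero] using h2

lemma exists_ringHom_ringOfIntegers {F K : Type*} [Field F] [Field K] [NumberField K]
    [IsCyclotomicExtension {f} ℚ K] {ζ : K} (hζ : IsPrimitiveRoot ζ f) {z : F}
    (hz : IsPrimitiveRoot z f) : ∃ φ : 𝓞 K →+* F, φ hζ.toInteger = z := by
  have h : Polynomial.aeval z (minpoly ℤ hζ.integralPowerBasis.gen) = 0 := by
    have hc : (hζ.toInteger : K) = ζ := rfl
    rw [hζ.integralPowerBasis_gen, ← NumberField.RingOfIntegers.minpoly_coe, hc,
      ← Polynomial.cyclotomic_eq_minpoly hζ (NeZero.pos f),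
      Polynomial.aeval_def, ← Polynomial.eval_map, Polynomial.map_cyclotomic]
    exact hz.isRoot_cyclotomic (NeZero.pos f)
  refine ⟨hζ.integralPowerBasis.lift z h, ?_⟩
  rw [← hζ.integralPowerBasis_gen]
  exact hζ.integralPowerBasis.lift_gen z h

variable {p : ℕ} {F : Type*} [Field F] [Finite F] [CharP F p]

lemma pow_orderOf_le_natAbs_norm {K : Type*} [Field K] [NumberField K] {w : 𝓞 K} (φ : 𝓞 K →+* F)
    (hw : IsPrimitiveRoot (φ w) f) {x : 𝓞 K} (hx : φ x = 0) (hx0 : x ≠ 0) :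
    p ^ orderOf (p : ZMod f) ≤ (Algebra.norm ℤ x).natAbs := by
  have hp : p ≠ 0 := CharP.char_ne_zero_of_finite F p
  obtain ⟨m, hm, hle⟩ := orderOf_le_of_primitiveRoot_mem_subring (p := p) hw φ.range ⟨w, rfl⟩
  have hker : Ideal.absNorm (RingHom.ker φ) = p ^ m := by
    rw [Ideal.absNorm_apply, Submodule.cardQuot_apply, ← hm]
    exact Nat.card_congr (RingHom.quotientKerEquivRange φ).toEquiv
  calc p ^ orderOf (p : ZMod f) ≤ p ^ m := Nat.pow_le_pow_right (Nat.pos_of_ne_zero hp) hle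
    _ = Ideal.absNorm (RingHom.ker φ) := hker.symm
    _ ≤ Ideal.absNorm (Ideal.span {x}) := by
        refine Nat.le_of_dvd (Nat.pos_of_ne_zero ?_) (Ideal.absNorm_dvd_absNorm_of_le ?_)
        · simpa [Ideal.absNorm_eq_zero_iff] using hx0
        · simpa [Ideal.span_singleton_le_iff_mem] using hx
    _ = (Algebra.norm ℤ x).natAbs := Ideal.absNorm_span_singleton x

/-- A vanishing sum of roots of unity with small coefficients over a finite field already
vanishes in characteristic zero. -/
lemma exists_complex_addChar_sum_eq_zero {ι : Type*} [Fintype ι] {z : F}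
    (hz : IsPrimitiveRoot z f) {M : ℕ} (hM : 3 ≤ M)
    (hp : M ^ f < (p ^ orderOf (p : ZMod f)) ^ 2) (c : ι → ℤ) (k : ι → ZMod f)
    (hE : (∑ i, ∑ j, if k i = k j then c i * c j else 0) ≤ (M : ℤ))
    (h0 : ∑ i, (c i : F) * AddChar.zmodChar f hz.pow_eq_one (k i) = 0) :
    ∃ χ : AddChar (ZMod f) ℂ, Function.Injective χ ∧ ∑ i, (c i : ℂ) * χ (k i) = 0 := by
  obtain ⟨K, _, _, _, ζ, hζ⟩ : ∃ (K : Type) (_ : Field K) (_ : NumberField K)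
      (_ : IsCyclotomicExtension {f} ℚ K) (ζ : K), IsPrimitiveRoot ζ f :=
    have : @IsCyclotomicExtension {f} ℚ (CyclotomicField f ℚ) _ _ DivisionRing.toRatAlgebra := by
      convert CyclotomicField.isCyclotomicExtension f ℚ
      · rfl
      · exact Subsingleton.elim _ _
    ⟨CyclotomicField f ℚ, inferInstance, inferInstance, this, _,
      IsCyclotomicExtension.zeta_spec f ℚ _⟩
  obtain ⟨φ, hφ⟩ := exists_ringHom_ringOfIntegers hζ hz
  set x : 𝓞 K := ∑ i, (c i : 𝓞 K) *
    AddChar.zmodChar f hζ.toInteger_isPrimitiveRoot.pow_eq_one (k i) with hx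
  have hxK : (x : K) = ∑ i, (c i : K) * AddChar.zmodChar f hζ.pow_eq_one (k i) := by
    simp only [hx, AddChar.zmodChar_apply, map_sum, map_mul, map_pow, map_intCast]
    rfl
  have hφx : φ x = 0 := by
    rw [← h0]
    simp [hx, AddChar.zmodChar_apply, hφ]
  have hx0 : x = 0 := by
    by_contra hne
    have h1 := pow_orderOf_le_natAbs_norm (p := p) φ (hφ.symm ▸ hz) hφx hne
    have h2 := norm_sq_le_of_energy_le hζ c k hM hE
    rw [← hxK, ← Algebra.coe_norm_int] at h2
    have h3 : (((Algebra.norm ℤ x).natAbs ^ 2 : ℕ) : ℝ) ≤ ((M ^ f : ℕ) : ℝ) := by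
      push_cast
      simpa using h2
    have h4 : (Algebra.norm ℤ x).natAbs ^ 2 ≤ M ^ f := by exact_mod_cast h3
    exact absurd (hp.trans_le (Nat.pow_le_pow_left h1 2)) (not_lt.mpr h4)
  obtain ⟨σ⟩ : Nonempty (K →+* ℂ) := inferInstance
  have hσ := hζ.map_of_injective σ.injective
  refine ⟨AddChar.zmodChar f hσ.pow_eq_one, zmodChar_injective hσ, ?_⟩
  have h5 : σ (x : K) = 0 := by rw [hx0]; simp
  rw [hxK] at h5
  simpa [AddChar.zmodChar_apply] using h5

end Reduction

section Triangles

open Finset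

lemma energy_three_le {G : Type*} [DecidableEq G] (P : Fin 3 → G) :
    (∑ i, ∑ j, if P i = P j then (1 : ℤ) else 0) ≤ 9 := by
  calc (∑ i, ∑ j, if P i = P j then (1 : ℤ) else 0) ≤ ∑ _i : Fin 3, ∑ _j : Fin 3, 1 := by
        gcongr; split_ifs <;> simp
    _ = 9 := by simp

lemma energy_three_le_of_not_const {G : Type*} [DecidableEq G] {P : Fin 3 → G}
    (hP : ¬ (P 0 = P 1 ∧ P 1 = P 2)) :
    (∑ i, ∑ j, if P i = P j then (1 : ℤ) else 0) ≤ 5 := by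
  simp only [Fin.sum_univ_three]
  grind

lemma energy_signed_le {G : Type*} [DecidableEq G] {P Q : Fin 3 → G}
    (h : ¬ ((P 0 = P 1 ∧ P 1 = P 2) ∧ (Q 0 = Q 1 ∧ Q 1 = Q 2))) :
    (∑ i, ∑ j, if Sum.elim P Q i = Sum.elim P Q j then
      Sum.elim (fun _ => 1) (fun _ => -1) i * Sum.elim (fun _ => 1) (fun _ => -1) j else 0) ≤
      (14 : ℤ) := by
  have cross (P Q : Fin 3 → G) {c : ℤ} (hc : c ≤ 0) : (∑ i, ∑ j, if P i = Q j then c else 0) ≤ 0 :=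
    sum_nonpos fun _ _ => sum_nonpos fun _ _ => by split_ifs <;> simp [hc]
  have hPQ := cross P Q (c := -1) (by norm_num)
  have hQP := cross Q P (c := -1) (by norm_num)
  simp only [Fintype.sum_sum_type, Sum.elim_inl, Sum.elim_inr, sum_add_distrib, mul_one, mul_neg,
    neg_neg]
  change (∑ i, ∑ j, if P i = P j then (1 : ℤ) else 0) + (∑ i, ∑ j, if Q i = P j then -1 else 0) +
    ((∑ i, ∑ j, if P i = Q j then -1 else 0) + (∑ i, ∑ j, if Q i = Q j then 1 else 0)) ≤ 14
  have hP := energy_three_le P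
  have hQ := energy_three_le Q
  rcases not_and_or.mp h with h | h
  · linarith [energy_three_le_of_not_const h]
  · linarith [energy_three_le_of_not_const h]

lemma mul_eq_mul_of_triangle {K : Type*} [Field K] {x₀ x₁ x₂ y₀ y₁ y₂ : K} (hx₀ : x₀ ≠ 0)
    (hx₁ : x₁ ≠ 0) (hx₂ : x₂ ≠ 0) (hy₀ : y₀ ≠ 0) (hy₁ : y₁ ≠ 0) (hy₂ : y₂ ≠ 0) (hx : x₀ ≠ x₁)
    (hy : y₁ ≠ y₂) (h : (x₀ - x₁) * (y₁ - y₂) = (x₁ - x₂) * (y₀ - y₁))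
    (hinv : (x₀⁻¹ - x₁⁻¹) * (y₁⁻¹ - y₂⁻¹) = (x₁⁻¹ - x₂⁻¹) * (y₀⁻¹ - y₁⁻¹)) :
    x₀ * y₂ = x₂ * y₀ := by
  rw [inv_sub_inv hx₀ hx₁, inv_sub_inv hy₁ hy₂, inv_sub_inv hx₁ hx₂, inv_sub_inv hy₀ hy₁,
    div_mul_div_comm, div_mul_div_comm, div_eq_div_iff (by simp [*]) (by simp [*])] at hinv
  refine mul_left_cancel₀ (mul_ne_zero (mul_ne_zero hx₁ hy₁)
    (mul_ne_zero (sub_ne_zero.mpr hx) (sub_ne_zero.mpr hy))) ?_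
  linear_combination x₁ * y₁ * x₀ * y₂ * h - hinv

/-- Two similar, equally oriented triangles inscribed in the unit circle differ by a rotation. -/
lemma addChar_complex_triangle {G : Type*} [AddCommGroup G] [Finite G] {χ : AddChar G ℂ}
    (hχ : Function.Injective χ) {a b : Fin 3 → G} (ha : Function.Injective a)
    (hb : Function.Injective b)
    (h : (χ (a 0) - χ (a 1)) * (χ (b 1) - χ (b 2)) =
      (χ (a 1) - χ (a 2)) * (χ (b 0) - χ (b 1))) (t : Fin 3) :
    a t - b t = a 0 - b 0 := by
  have hne (x : G) : χ x ≠ 0 := (χ.val_isUnit x).ne_zero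
  have hconj : ((χ (a 0))⁻¹ - (χ (a 1))⁻¹) * ((χ (b 1))⁻¹ - (χ (b 2))⁻¹) =
      ((χ (a 1))⁻¹ - (χ (a 2))⁻¹) * ((χ (b 0))⁻¹ - (χ (b 1))⁻¹) := by
    simpa [AddChar.inv_apply_eq_conj] using congrArg (starRingEnd ℂ) h
  have shift {x y u v : G} (e : χ x * χ v = χ u * χ y) : x - y = u - v := by
    rw [← χ.map_add_eq_mul, ← χ.map_add_eq_mul] at e
    rw [sub_eq_sub_iff_add_eq_add]
    exact hχ e
  have h2 : a 0 - b 0 = a 2 - b 2 :=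
    shift (mul_eq_mul_of_triangle (hne _) (hne _) (hne _) (hne _) (hne _) (hne _)
      (fun e => by simpa using ha (hχ e))
      (fun e => by simpa using hb (hχ e)) h hconj)
  have h1 : a 1 - b 1 = a 2 - b 2 :=
    shift (mul_eq_mul_of_triangle (x₁ := χ (a 0)) (y₁ := χ (b 0)) (hne _) (hne _) (hne _)
      (hne _) (hne _) (hne _) (fun e => by simpa using ha (hχ e))
      (fun e => by simpa using hb (hχ e)) (by linear_combination -h)
      (by linear_combination -hconj))
  fin_cases t
  · rfl
  · exact h1.trans h2.symm
  · exact h2.symm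

variable {f : ℕ} [NeZero f] {p : ℕ} {F : Type*} [Field F] [Finite F] [CharP F p]

/-- Over a finite field, two triples of distinct `f`-th roots of unity that are related by an
affine map are related by a multiplication. -/
lemma zmodChar_triangle {z : F} (hz : IsPrimitiveRoot z f)
    (hp : 14 ^ f < (p ^ orderOf (p : ZMod f)) ^ 2) {a b : Fin 3 → ZMod f}
    (ha : Function.Injective a) (hb : Function.Injective b) {ψ : AddChar (ZMod f) F}
    (hψ : ψ = AddChar.zmodChar f hz.pow_eq_one)
    (h : (ψ (a 0) - ψ (a 1)) * (ψ (b 1) - ψ (b 2)) =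
      (ψ (a 1) - ψ (a 2)) * (ψ (b 0) - ψ (b 1))) (t : Fin 3) :
    a t - b t = a 0 - b 0 := by
  have hinj : Function.Injective ψ := hψ ▸ zmodChar_injective hz
  set P : Fin 3 → ZMod f := ![a 0 + b 1, a 1 + b 2, a 2 + b 0] with hP
  set Q : Fin 3 → ZMod f := ![a 0 + b 2, a 1 + b 0, a 2 + b 1] with hQ
  have h0 : ∑ i, ((Sum.elim (fun _ => 1) (fun _ => -1) i : ℤ) : F) * ψ (Sum.elim P Q i) = 0 := by
    simp only [Fintype.sum_sum_type, Fin.sum_univ_three, hP, hQ, Sum.elim_inl, Sum.elim_inr,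
      Matrix.cons_val, AddChar.map_add_eq_mul]
    push_cast
    linear_combination h
  by_cases hconst : (P 0 = P 1 ∧ P 1 = P 2) ∧ (Q 0 = Q 1 ∧ Q 1 = Q 2)
  · exfalso
    obtain ⟨⟨hP1, hP2⟩, hQ1, hQ2⟩ := hconst
    simp only [hP, hQ, Matrix.cons_val] at hP1 hP2 hQ1 hQ2
    have h3 : (3 : F) * (ψ (P 0) - ψ (Q 0)) = 0 := by
      simp only [Fintype.sum_sum_type, Fin.sum_univ_three, hP, hQ, Sum.elim_inl, Sum.elim_inr,
        Matrix.cons_val, ← hP2, ← hP1, ← hQ2, ← hQ1] at h0 ⊢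
      push_cast at h0
      linear_combination h0
    have hb12 : b 1 - b 2 ≠ 0 := sub_ne_zero.mpr fun e => by simpa using hb e
    rcases mul_eq_zero.mp h3 with h3 | h3
    · have hd : (3 : ℕ) • (b 1 - b 2) = 0 := by
        linear_combination 2 * (hP1 - hQ1) + (hP2 - hQ2)
      have hcube : ψ (b 1 - b 2) ^ 3 = 1 := by
        rw [← ψ.map_nsmul_eq_pow, hd, ψ.map_zero_eq_one]
      have : (ψ (b 1 - b 2) - 1) ^ 3 = 0 := by
        linear_combination hcube + (ψ (b 1 - b 2) - ψ (b 1 - b 2) ^ 2) * h3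
      have h1 : ψ (b 1 - b 2) = 1 := sub_eq_zero.mp (pow_eq_zero_iff (by norm_num) |>.mp this)
      exact hb12 (AddChar.injective_iff.mp hinj h1)
    · have := hinj (sub_eq_zero.mp h3)
      simp only [hP, hQ, Matrix.cons_val] at this
      exact hb12 (by linear_combination this)
  · subst hψ
    obtain ⟨χ, hχ, hsum⟩ := exists_complex_addChar_sum_eq_zero hz (by norm_num) hp _ _
      (energy_signed_le hconst) h0
    refine addChar_complex_triangle hχ ha hb ?_ t
    simp only [Fintype.sum_sum_type, Fin.sum_univ_three, hP, hQ, Sum.elim_inl, Sum.elim_inr,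
      Matrix.cons_val, AddChar.map_add_eq_mul] at hsum
    push_cast at hsum
    linear_combination hsum

end Triangles

section ReedSolomon

lemma charP_of_card_eq_pow {F : Type*} [Field F] [Fintype F] {p s : ℕ} (hp : p.Prime)
    (hq : Fintype.card F = p ^ s) : CharP F p := by
  have h0 : (p : F) = 0 := by
    have := FiniteField.cast_card_eq_zero F
    rw [hq, Nat.cast_pow] at this
    exact eq_zero_of_pow_eq_zero this
  refine ringChar.of_eq ?_
  exact (hp.eq_one_or_self_of_dvd _ (ringChar.dvd h0)).resolve_left CharP.ringChar_ne_one

lemma exists_isPrimitiveRoot_of_card_sub_one_eq_mul {F : Type*} [Field F] [Fintype F] {e f : ℕ}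
    (h : Fintype.card F - 1 = e * f) : ∃ z : F, IsPrimitiveRoot z f := by
  classical
  obtain ⟨g, hg⟩ := IsCyclic.exists_ofOrder_eq_natCard (α := Fˣ)
  rw [Nat.card_eq_fintype_card, Fintype.card_units] at hg
  have hpos : 0 < Fintype.card F - 1 := Nat.sub_pos_of_lt Fintype.one_lt_card
  have hprim : IsPrimitiveRoot (g : F) (Fintype.card F - 1) :=
    IsPrimitiveRoot.coe_units_iff.mpr (hg ▸ IsPrimitiveRoot.orderOf g)
  exact ⟨_, hprim.pow hpos h⟩

lemma pow_lt_sq_of_lt_logb_sqrt {M f X : ℕ} (hM : 1 < M) (hX : 0 < X)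
    (h : (f : ℝ) < Real.logb (Real.sqrt M) X) : M ^ f < X ^ 2 := by
  have h1 : (1 : ℝ) < Real.sqrt M := Real.lt_sqrt_of_sq_lt (by simpa using hM)
  rw [Real.lt_logb_iff_rpow_lt h1 (by exact_mod_cast hX), Real.rpow_natCast] at h
  have h2 : (Real.sqrt M ^ f) ^ 2 < (X : ℝ) ^ 2 := by gcongr
  rw [← pow_mul, mul_comm, pow_mul, Real.sq_sqrt (Nat.cast_nonneg M)] at h2
  exact_mod_cast h2

lemma eq_of_three_differences {G : Type*} [AddCommGroup G] [DecidableEq G] {T : Finset G}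
    (hT : ∀ z : G, z ≠ 0 → ((T ×ˢ T).filter fun xy => xy.1 - xy.2 = z).card ≤ 2)
    {a b : Fin 3 → G} (ha : Function.Injective a) (haT : ∀ t, a t ∈ T) (hbT : ∀ t, b t ∈ T)
    (h : ∀ t, a t - b t = a 0 - b 0) : a = b := by
  by_contra hne
  have hz : a 0 - b 0 ≠ 0 := fun h0 => hne (funext fun t => sub_eq_zero.mp ((h t).trans h0))
  have hcard : (Finset.univ.map
      ⟨fun t => (a t, b t), fun i j hij => ha (congrArg Prod.fst hij)⟩).card ≤
      ((T ×ˢ T).filter fun xy => xy.1 - xy.2 = a 0 - b 0).card := by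
    refine Finset.card_le_card fun xy hxy => ?_
    obtain ⟨t, -, rfl⟩ := Finset.mem_map.mp hxy
    simpa using ⟨⟨haT t, hbT t⟩, h t⟩
  have := hcard.trans (hT _ hz)
  simp at this

/-- If distinct codewords of a two-dimensional Reed–Solomon code agree along two triples of
distinct positions, the triples of evaluation points are distinct and similar. -/
lemma affine_matching {F : Type*} [Field F] {x y : Fin 3 → F} (hx : Function.Injective x)
    (hy : Function.Injective y) {a b a' b' : F} (hne : ¬ (a = a' ∧ b = b'))
    (h : ∀ t, a * x t + b = a' * y t + b') :
    x ≠ y ∧ (x 0 - x 1) * (y 1 - y 2) = (x 1 - x 2) * (y 0 - y 1) := by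
  have ha : a ≠ 0 := by
    rintro rfl
    have h01 : a' * (y 0 - y 1) = 0 := by linear_combination h 1 - h 0
    have ha' : a' = 0 :=
      (mul_eq_zero.mp h01).resolve_right (sub_ne_zero.mpr fun e => by simpa using hy e)
    exact hne ⟨ha'.symm, by simpa [ha'] using h 0⟩
  refine ⟨?_, mul_left_cancel₀ ha ?_⟩
  · rintro rfl
    have h01 : (a - a') * (x 0 - x 1) = 0 := by linear_combination h 0 - h 1
    have haa : a = a' := sub_eq_zero.mp <|
      (mul_eq_zero.mp h01).resolve_right (sub_ne_zero.mpr fun e => by simpa using hx e)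
    exact hne ⟨haa, by simpa [haa] using h 0⟩
  · linear_combination (y 1 - y 2) * (h 0 - h 1) - (y 0 - y 1) * (h 1 - h 2)

end ReedSolomon

/-- let `q = p^s` with `q - 1 = ef` (`e, f > 1`) and
`f < log_{√14}(p^(ord_f(p)))`. If there is a subset `T ⊆ ℤ_f` of size `n` such that every
nonzero element of `ℤ_f` appears at most twice in the multiset `T - T`, then there is a
2-dimensional Reed–Solomon code over `F_q` of length `n` with minimum insdel distance at
least `2n - 4`. -/
theorem exists_rs_code_insdel_distance_ge_two_mul_length_sub_four
    {F : Type*} [Field F] [Fintype F] (p s e f n : ℕ) (hp : p.Prime) (hs : 1 ≤ s)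
    (hq : Fintype.card F = p ^ s)
    (he : 1 < e) (hf : 1 < f) (hef : p ^ s - 1 = e * f)
    (hflog : (f : ℝ) < Real.logb (Real.sqrt 14) ((p : ℝ) ^ orderOf (p : ZMod f)))
    (T : Finset (ZMod f)) (hTn : T.card = n)
    (hT : ∀ z : ZMod f, z ≠ 0 →
      ((T ×ˢ T).filter fun xy => xy.1 - xy.2 = z).card ≤ 2) :
    ∃ α : Fin n → F, Function.Injective α ∧
      2 * n - 4 ≤ codeInsdelDist {c | ∃ a b : F, c = fun i => a * α i + b} := by
  have : NeZero f := ⟨by omega⟩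
  have : CharP F p := charP_of_card_eq_pow hp hq
  obtain ⟨z, hz⟩ := exists_isPrimitiveRoot_of_card_sub_one_eq_mul (hq ▸ hef)
  have hbound : 14 ^ f < (p ^ orderOf (p : ZMod f)) ^ 2 :=
    pow_lt_sq_of_lt_logb_sqrt (by norm_num) (pow_pos hp.pos _) (by exact_mod_cast hflog)
  set ψ := AddChar.zmodChar f hz.pow_eq_one with hψ
  have hinj : Function.Injective ψ := zmodChar_injective hz
  set τ : Fin n ≃ T := (T.equivFinOfCardEq hTn).symm
  have hτ : Function.Injective fun i => (τ i : ZMod f) := Subtype.val_injective.comp τ.injective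
  refine ⟨fun i => ψ (τ i), hinj.comp hτ, ?_⟩
  rcases Nat.eq_zero_or_pos n with rfl | hn
  · simp
  refine le_csInf ⟨_, _, ⟨0, 0, rfl⟩, _, ⟨0, 1, rfl⟩,
    fun h => by simpa using congrFun h ⟨0, hn⟩, rfl⟩ ?_
  rintro _ ⟨_, ⟨a, b, rfl⟩, _, ⟨a', b', rfl⟩, hne, rfl⟩
  by_contra! hlt
  obtain ⟨w, hw, hw', hlen⟩ := exists_common_sublist
    (List.ofFn fun i => a * ψ (τ i) + b) (List.ofFn fun i => a' * ψ (τ i) + b')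
  simp only [List.length_ofFn] at hlen
  obtain ⟨i, j, hi, hj, hij⟩ :=
    exists_injective_matching_of_sublist_ofFn hw hw' (k := 3) (by omega)
  obtain ⟨hxy, htri⟩ := affine_matching (hinj.comp (hτ.comp hi)) (hinj.comp (hτ.comp hj))
    (by rintro ⟨rfl, rfl⟩; exact hne rfl) hij
  have hdiff := zmodChar_triangle hz hbound (hτ.comp hi) (hτ.comp hj) hψ htri
  have heq := eq_of_three_differences hT (hτ.comp hi) (fun t => (τ (i t)).2)
    (fun t => (τ (j t)).2) hdiff
  exact hxy (funext fun t => congrArg ψ (congrFun heq t))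
end

section
/- For every prime power r, there exists a subset T of ℤ_{r² + r + 1} (the integers modulo r² + r + 1) with |T| = r + 1 such that every nonzero element of ℤ_{r² + r + 1} appears exactly once in the multiset { x − y : x, y ∈ T, x ≠ y }. -/
theorem IsCyclic.exists_surjective_zmod_of_card_eq_mul {G : Type*} [Group G] [Finite G]
    [IsCyclic G] {m n : ℕ} (hcard : Nat.card G = m * n) :
    ∃ φ : G →* Multiplicative (ZMod n), Function.Surjective φ ∧ ∀ g, g ^ m = 1 → φ g = 1 := by
  have hm : 0 < m := Nat.pos_of_mul_pos_right (hcard ▸ Nat.card_pos)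
  have hn : 0 < n := Nat.pos_of_mul_pos_left (hcard ▸ Nat.card_pos)
  have : NeZero (m * n) := ⟨(Nat.mul_pos hm hn).ne'⟩
  have e : Multiplicative (ZMod (m * n)) ≃* G := hcard ▸ zmodCyclicMulEquiv ‹IsCyclic G›
  let π : ZMod (m * n) →+* ZMod n := ZMod.castHom (dvd_mul_left n m) (ZMod n)
  refine ⟨(AddMonoidHom.toMultiplicative π.toAddMonoidHom).comp e.symm.toMonoidHom, ?_, ?_⟩
  · exact (ZMod.ringHom_surjective π).comp e.symm.surjective
  · intro g hg
    obtain ⟨x, rfl⟩ := e.surjective g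
    have hx : m • x.toAdd = 0 := by
      rw [← map_pow, EmbeddingLike.map_eq_one_iff] at hg
      exact hg
    suffices h : π x.toAdd = 0 by
      simpa using h
    rw [← ZMod.natCast_zmod_val x.toAdd] at hx ⊢
    rw [nsmul_eq_mul, ← Nat.cast_mul, ZMod.natCast_eq_zero_iff] at hx
    rw [map_natCast, ZMod.natCast_eq_zero_iff]
    exact Nat.dvd_of_mul_dvd_mul_left hm hx

/-- If `T` has at most `k + 1` elements and its differences cover the nonzero elements of a group
of order `k² + k + 1`, then every nonzero element is a difference exactly once. -/
theorem Finset.card_eq_and_card_filter_sub_eq_one {A : Type*} [AddCommGroup A] [Fintype A]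
    [DecidableEq A] {k : ℕ} (hk : 0 < k) (hA : Fintype.card A = k ^ 2 + k + 1)
    {T : Finset A} (hT : T.card ≤ k + 1) (hcover : ∀ z : A, z ≠ 0 → ∃ x ∈ T, ∃ y ∈ T, x - y = z) :
    T.card = k + 1 ∧ ∀ z : A, z ≠ 0 →
      ((T ×ˢ T).filter fun xy => xy.1 ≠ xy.2 ∧ xy.1 - xy.2 = z).card = 1 := by
  set N : A → ℕ := fun z =>
    ((T ×ˢ T).filter fun xy => xy.1 ≠ xy.2 ∧ xy.1 - xy.2 = z).card with hN
  have hpos : ∀ z ∈ univ.erase (0 : A), 1 ≤ N z := by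
    intro z hz
    have hz0 := ne_of_mem_erase hz
    obtain ⟨x, hx, y, hy, rfl⟩ := hcover z hz0
    exact card_pos.2 ⟨(x, y), by simp [hx, hy, sub_ne_zero.1 hz0]⟩
  have hsum : ∑ z ∈ univ.erase (0 : A), N z = T.card * T.card - T.card := by
    rw [← offDiag_card, card_eq_sum_card_fiberwise (f := fun xy : A × A => xy.1 - xy.2)
      (t := univ.erase (0 : A)) (fun xy h => by simp_all [sub_eq_zero])]
    refine sum_congr rfl fun z _ => congrArg card ?_
    ext xy
    simp [and_assoc]
  have hone : ∑ z ∈ univ.erase (0 : A), 1 = k ^ 2 + k := by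
    simp [card_erase_of_mem, hA]
  have hle := sum_le_sum hpos
  rw [hone, hsum] at hle
  have hcard : T.card = k + 1 := by
    refine le_antisymm hT (not_lt.1 fun hlt => ?_)
    have hTk : T.card ≤ k := Nat.lt_succ_iff.1 hlt
    have : k ^ 2 + k ≤ k * k :=
      hle.trans ((Nat.sub_le _ _).trans (Nat.mul_le_mul hTk hTk))
    nlinarith
  refine ⟨hcard, fun z hz => ?_⟩
  have heq : ∑ z ∈ univ.erase (0 : A), 1 = ∑ z ∈ univ.erase (0 : A), N z := by
    rw [hone, hsum, hcard]
    refine (Nat.sub_eq_of_eq_add ?_).symm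
    ring
  exact ((sum_eq_sum_iff_of_le hpos).1 heq z (by simp [hz])).symm

section Field

variable {F K : Type*} [Field F] [Field K] [Algebra F K]

/-- Representatives of the points of the projective line spanned by `1` and `θ`. -/
def projectiveLinePoint (F : Type*) {K : Type*} [Field F] [Field K] [Algebra F K] (θ : K) :
    Option F → K
  | none => 1
  | some a => θ + algebraMap F K a

theorem projectiveLinePoint_ne_zero {θ : K} (hθ : θ ∉ Set.range (algebraMap F K))
    (o : Option F) : projectiveLinePoint F θ o ≠ 0 := by
  cases o with
  | none => exact one_ne_zero
  | some a =>
    intro h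
    exact hθ ⟨-a, by rw [map_neg]; exact (eq_neg_of_add_eq_zero_left h).symm⟩

theorem exists_eq_mul_projectiveLinePoint (θ : K) {v : F × F} (hv : v ≠ 0) :
    ∃ c : F, c ≠ 0 ∧ ∃ o : Option F,
      algebraMap F K v.1 + algebraMap F K v.2 * θ =
        algebraMap F K c * projectiveLinePoint F θ o := by
  obtain ⟨a, b⟩ := v
  by_cases hb : b = 0
  · subst hb
    exact ⟨a, fun ha => hv (by simp [ha]), none, by simp [projectiveLinePoint]⟩
  · refine ⟨b, hb, some (a / b), ?_⟩
    have : algebraMap F K b ≠ 0 := by simpa using hb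
    simp only [projectiveLinePoint, map_div₀]
    field_simp
    ring

/-- In a cubic extension, a line in the projective plane meets each of its translates. -/
theorem exists_mul_projectiveLinePoint_eq (hdim : Module.finrank F K = 3) {θ : K}
    (hθ : θ ∉ Set.range (algebraMap F K)) {g : K} (hg : g ≠ 0) :
    ∃ c d : F, c ≠ 0 ∧ d ≠ 0 ∧ ∃ o o' : Option F,
      algebraMap F K c * projectiveLinePoint F θ o =
        g * (algebraMap F K d * projectiveLinePoint F θ o') := by
  have : FiniteDimensional F K := Module.finite_of_finrank_pos (by omega)
  let L : F × F →ₗ[F] K :=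
    (Algebra.linearMap F K).coprod ((LinearMap.mulRight F θ).comp (Algebra.linearMap F K))
  have hL : ∀ v, L v = algebraMap F K v.1 + algebraMap F K v.2 * θ := fun v => by simp [L]
  have hne : ∀ v, v ≠ 0 → L v ≠ 0 := by
    intro v hv
    obtain ⟨c, hc, o, h⟩ := exists_eq_mul_projectiveLinePoint θ hv
    rw [hL, h]
    exact mul_ne_zero (by simpa using hc) (projectiveLinePoint_ne_zero hθ o)
  obtain ⟨⟨u, v⟩, huv, huv0⟩ := (Submodule.ne_bot_iff _).1
    (LinearMap.ker_ne_bot_of_finrank_lt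
      (f := L.coprod (-((LinearMap.mulLeft F g).comp L))) (by simp [hdim]))
  have heq : L u = g * L v := by
    rw [← sub_eq_zero, sub_eq_add_neg]
    simpa using huv
  have hu : u ≠ 0 := by
    rintro rfl
    rw [map_zero] at heq
    have hv : v = 0 := by
      by_contra hv
      exact mul_ne_zero hg (hne v hv) heq.symm
    exact huv0 (by rw [hv]; rfl)
  have hv : v ≠ 0 := by
    rintro rfl
    rw [map_zero, mul_zero] at heq
    exact hne u hu heq
  obtain ⟨c, hc, o, ho⟩ := exists_eq_mul_projectiveLinePoint θ hu
  obtain ⟨d, hd, o', ho'⟩ := exists_eq_mul_projectiveLinePoint θ hv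
  exact ⟨c, d, hc, hd, o, o', by rw [← ho, ← ho', ← hL, ← hL, heq]⟩

end Field

/-- Singer's construction in the cubic extension of a finite field. -/
theorem exists_finset_zmod_sub_cover (F K : Type*) [Field F] [Finite F] [Field K] [Finite K]
    [Algebra F K] (hdim : Module.finrank F K = 3) {r : ℕ} (hr : Nat.card F = r) :
    ∃ T : Finset (ZMod (r ^ 2 + r + 1)), T.card ≤ r + 1 ∧
      ∀ z : ZMod (r ^ 2 + r + 1), z ≠ 0 → ∃ x ∈ T, ∃ y ∈ T, x - y = z := by
  have := Fintype.ofFinite F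
  have hcard : Nat.card Kˣ = (r - 1) * (r ^ 2 + r + 1) := by
    rw [Nat.card_units, Module.natCard_eq_pow_finrank (K := F), hdim, hr]
    obtain ⟨s, rfl⟩ : ∃ s, r = s + 1 := Nat.exists_eq_succ_of_ne_zero (hr ▸ Nat.card_pos.ne')
    refine Nat.sub_eq_of_eq_add ?_
    rw [Nat.add_sub_cancel]
    ring
  obtain ⟨φ, hφ, hker⟩ := IsCyclic.exists_surjective_zmod_of_card_eq_mul hcard
  have hφF : ∀ c : Fˣ, φ (Units.map (algebraMap F K).toMonoidHom c) = 1 := fun c => by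
    apply hker
    rw [← map_pow, ← hr, ← Nat.card_units, pow_card_eq_one', map_one]
  obtain ⟨θ, hθ⟩ : ∃ θ : K, θ ∉ Set.range (algebraMap F K) := by
    by_contra! h
    have := (finrank_eq_one_iff_of_nonzero' (1 : K) one_ne_zero (K := F)).2 fun w => by
      obtain ⟨c, hc⟩ := h w
      exact ⟨c, by rw [← hc, Algebra.smul_def, mul_one]⟩
    omega
  let P : Option F → Kˣ := fun o => Units.mk0 _ (projectiveLinePoint_ne_zero hθ o)
  refine ⟨Finset.univ.image fun o => (φ (P o)).toAdd, ?_, fun z _ => ?_⟩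
  · refine Finset.card_image_le.trans ?_
    simp [← hr]
  · obtain ⟨g, hg⟩ := hφ (Multiplicative.ofAdd z)
    obtain ⟨c, d, hc, hd, o, o', h⟩ := exists_mul_projectiveLinePoint_eq hdim hθ g.ne_zero
    refine ⟨_, Finset.mem_image_of_mem _ (Finset.mem_univ o),
      _, Finset.mem_image_of_mem _ (Finset.mem_univ o'), ?_⟩
    have hunits : Units.map (algebraMap F K).toMonoidHom (Units.mk0 c hc) * P o =
        g * (Units.map (algebraMap F K).toMonoidHom (Units.mk0 d hd) * P o') := Units.ext h
    have hφP := congrArg φ hunits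
    simp only [map_mul, hφF, one_mul, hg] at hφP
    rw [hφP, toAdd_mul, toAdd_ofAdd, add_sub_cancel_right]

/-- for every prime power `r` there is a perfect difference set
`T ⊆ ℤ_{r² + r + 1}` with `|T| = r + 1`: every nonzero element of `ℤ_{r² + r + 1}` appears
exactly once in the multiset `{x - y : x, y ∈ T, x ≠ y}`. -/
theorem exists_perfect_difference_set
    (p k r : ℕ) (hp : p.Prime) (hk : 1 ≤ k) (hr : r = p ^ k) :
    ∃ T : Finset (ZMod (r ^ 2 + r + 1)), T.card = r + 1 ∧
      ∀ z : ZMod (r ^ 2 + r + 1), z ≠ 0 →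
        ((T ×ˢ T).filter fun xy => xy.1 ≠ xy.2 ∧ xy.1 - xy.2 = z).card = 1 := by
  have : Fact p.Prime := ⟨hp⟩
  have hF : Nat.card (GaloisField p k) = r := by rw [GaloisField.card p k (by omega), hr]
  have hr0 : 0 < r := hr ▸ pow_pos hp.pos k
  obtain ⟨T, hT, hcover⟩ := exists_finset_zmod_sub_cover (GaloisField p k)
    (FiniteField.Extension (GaloisField p k) p 3) (FiniteField.finrank_extension _ p 3) hF
  exact ⟨T, Finset.card_eq_and_card_filter_sub_eq_one hr0 (ZMod.card _) hT hcover⟩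
end

section
/- For every integer f ≥ 2, there exists a subset T of ℤ_f with |T| ≥ ⌈√f / 2⌉ such that every nonzero element of ℤ_f appears at most twice in the multiset T − T = {x − y : x, y ∈ T}. -/
/-- A Sidon set of naturals below `f` reduces to a set of residues modulo `f` of the same size in
which every nonzero difference occurs at most twice. -/
theorem exists_card_eq_and_card_filter_sub_le_two_of_sidon {f : ℕ} (hf : 0 < f) (S : Finset ℕ)
    (hlt : ∀ a ∈ S, a < f)
    (hS : ∀ a ∈ S, ∀ b ∈ S, ∀ c ∈ S, ∀ d ∈ S, a ≠ b → a + d = c + b → a = c) :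
    ∃ T : Finset (ZMod f), T.card = S.card ∧
      ∀ z : ZMod f, z ≠ 0 → ((T ×ˢ T).filter fun xy => xy.1 - xy.2 = z).card ≤ 2 := by
  have : NeZero f := ⟨hf.ne'⟩
  have hval : ∀ a ∈ S, ((a : ℕ) : ZMod f).val = a := fun a ha => ZMod.val_cast_of_lt (hlt a ha)
  refine ⟨S.image fun a : ℕ => (a : ZMod f), Finset.card_image_of_injOn fun a ha b hb h => ?_,
    fun z hz => ?_⟩
  · rw [← hval a ha, ← hval b hb]
    exact congrArg ZMod.val h
  · refine (Finset.card_le_card_of_injOn (t := {(z.val : ℤ), (z.val : ℤ) - f})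
      (fun xy : ZMod f × ZMod f => (xy.1.val : ℤ) - xy.2.val) ?_ ?_).trans Finset.card_le_two
    · rintro ⟨x, y⟩ hxy
      obtain ⟨-, rfl⟩ := Finset.mem_filter.1 hxy
      have hx := ZMod.val_lt x
      have hy := ZMod.val_lt y
      have hw := ZMod.val_lt (x - y)
      have hsum := ZMod.val_add (x - y) y
      rw [sub_add_cancel] at hsum
      simp only [Finset.coe_insert, Finset.coe_singleton, Set.mem_insert_iff,
        Set.mem_singleton_iff]
      rcases lt_or_ge ((x - y).val + y.val) f with h | h
      · rw [Nat.mod_eq_of_lt h] at hsum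
        omega
      · rw [Nat.mod_eq_sub_mod h, Nat.mod_eq_of_lt (by omega)] at hsum
        omega
    · rintro ⟨x, y⟩ hxy ⟨x', y'⟩ hxy' h
      simp only [Finset.coe_filter, Finset.mem_product, Finset.mem_image, Set.mem_ofPred_eq]
        at hxy hxy'
      obtain ⟨⟨⟨a, ha, rfl⟩, b, hb, rfl⟩, hab⟩ := hxy
      obtain ⟨⟨⟨c, hc, rfl⟩, d, hd, rfl⟩, -⟩ := hxy'
      simp only [hval a ha, hval b hb, hval c hc, hval d hd] at h
      have hne : a ≠ b := by
        rintro rfl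
        exact hz (by rw [← hab, sub_self])
      have hac : a = c := hS a ha b hb c hc d hd hne (by omega)
      have hbd : b = d := by omega
      rw [hac, hbd]

/-- Bose's construction: for every prime `p` there is a Sidon set of `p` naturals
below `p ^ 2 - 1`. -/
theorem exists_sidon_card_eq_prime (p : ℕ) (hp : p.Prime) :
    ∃ S : Finset ℕ, S.card = p ∧ (∀ a ∈ S, a < p ^ 2 - 1) ∧
      ∀ a ∈ S, ∀ b ∈ S, ∀ c ∈ S, ∀ d ∈ S, a ≠ b → a + d = c + b → a = c := by
  have : Fact p.Prime := ⟨hp⟩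
  let K := GaloisField p 2
  classical
  have hcard : Nat.card K = p ^ 2 := GaloisField.card p 2 two_ne_zero
  obtain ⟨θ, hθ⟩ : ∃ θ : K, ∀ i : ZMod p, algebraMap (ZMod p) K i ≠ θ := by
    by_contra! h
    have hle := Nat.card_le_card_of_surjective (algebraMap (ZMod p) K) h
    rw [hcard, Nat.card_zmod] at hle
    nlinarith [hp.two_le]
  obtain ⟨g, hg⟩ := IsCyclic.exists_generator (α := Kˣ)
  have horder : orderOf g = p ^ 2 - 1 := by
    rw [orderOf_eq_card_of_forall_mem_zpowers hg, Nat.card_units, hcard]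
  have hlog : ∀ i : ZMod p, ∃ n < p ^ 2 - 1, (g : K) ^ n = θ + algebraMap (ZMod p) K i := by
    intro i
    have hne : θ + algebraMap (ZMod p) K i ≠ 0 := fun h =>
      hθ (-i) (by rw [map_neg]; exact (eq_neg_of_add_eq_zero_left h).symm)
    obtain ⟨n, hn, hgn⟩ := Finset.mem_image.1
      (mem_zpowers_iff_mem_range_orderOf.1 (hg (Units.mk0 _ hne)))
    refine ⟨n, by rwa [Finset.mem_range, horder] at hn, ?_⟩
    simpa using congrArg Units.val hgn
  choose ℓ hℓ hpow using hlog
  have hinj : Function.Injective ℓ := fun i j h => by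
    have := hpow i
    rw [h, hpow j] at this
    exact ((algebraMap (ZMod p) K).injective (add_left_cancel this)).symm
  refine ⟨Finset.univ.image ℓ, ?_, ?_, ?_⟩
  · rw [Finset.card_image_of_injective _ hinj, Finset.card_univ, ZMod.card]
  · simpa using hℓ
  · simp only [Finset.mem_image, Finset.mem_univ, true_and, forall_exists_index,
      forall_apply_eq_imp_iff]
    intro i j k l hij h
    have hprod : (g : K) ^ ℓ i * (g : K) ^ ℓ l = (g : K) ^ ℓ k * (g : K) ^ ℓ j := by
      rw [← pow_add, ← pow_add, h]
    simp only [hpow] at hprod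
    have hlin : algebraMap (ZMod p) K (i + l - k - j) * θ
        = algebraMap (ZMod p) K (k * j - i * l) := by
      simp only [map_add, map_sub, map_mul]
      linear_combination hprod
    have hsum : i + l - k - j = 0 := by
      by_contra hne
      refine hθ ((k * j - i * l) / (i + l - k - j)) ?_
      rw [map_div₀, ← hlin, mul_div_cancel_left₀]
      exact (map_ne_zero _).2 hne
    have hmul : k * j - i * l = 0 := by
      rw [hsum, map_zero, zero_mul] at hlin
      exact (map_eq_zero _).1 hlin.symm
    have hfac : (i - k) * (i - j) = 0 := by
      linear_combination hmul + i * hsum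
    rcases mul_eq_zero.1 hfac with h0 | h0
    · rw [sub_eq_zero.1 h0]
    · exact absurd (congrArg ℓ (sub_eq_zero.1 h0)) hij

/-- for every `f ≥ 2` there exists `T ⊆ ℤ_f` with `|T| ≥ ⌈√f / 2⌉` such that
every nonzero element of `ℤ_f` appears at most twice in the multiset
`T - T = {x - y : x, y ∈ T}`. -/
theorem exists_large_set_with_difference_multiplicity_le_two
    (f : ℕ) (hf : 2 ≤ f) :
    ∃ T : Finset (ZMod f), ⌈Real.sqrt (f : ℝ) / 2⌉₊ ≤ T.card ∧
      ∀ z : ZMod f, z ≠ 0 →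
        ((T ×ˢ T).filter fun xy => xy.1 - xy.2 = z).card ≤ 2 := by
  rcases lt_or_ge f 4 with h4 | h4
  · refine ⟨{0}, ?_, fun z _ => (Finset.card_filter_le _ _).trans (by simp)⟩
    rw [Finset.card_singleton, Nat.ceil_le, Nat.cast_one, div_le_one two_pos]
    refine Real.sqrt_le_iff.2 ⟨two_pos.le, ?_⟩
    have : (f : ℝ) < 4 := by exact_mod_cast h4
    linarith
  · set n := ⌊Real.sqrt (f : ℝ) / 2⌋₊ with hn
    have hn0 : n ≠ 0 := by
      have : (2 : ℝ) ≤ Real.sqrt f := Real.le_sqrt_of_sq_le (by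
        have : (4 : ℝ) ≤ f := by exact_mod_cast h4
        linarith)
      exact (Nat.floor_pos.2 (by linarith)).ne'
    obtain ⟨p, hp, hnp, hpn⟩ := Nat.exists_prime_lt_and_le_two_mul n hn0
    have hpf : p ^ 2 ≤ f := by
      have h1 : (n : ℝ) ≤ Real.sqrt f / 2 := Nat.floor_le (by positivity)
      have h2 : (p : ℝ) ≤ 2 * n := by exact_mod_cast hpn
      have h3 : (p : ℝ) ^ 2 ≤ f := (Real.le_sqrt' (by exact_mod_cast hp.pos)).1 (by linarith)
      exact_mod_cast h3
    obtain ⟨S, hcard, hlt, hS⟩ := exists_sidon_card_eq_prime p hp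
    obtain ⟨T, hT, hz⟩ := exists_card_eq_and_card_filter_sub_le_two_of_sidon (f := f) (by omega) S
      (fun a ha => (hlt a ha).trans_le (by omega)) hS
    refine ⟨T, ?_, hz⟩
    rw [hT, hcard]
    exact (Nat.ceil_le_floor_add_one _).trans hnp
end
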